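/- arXiv:1410.0483 — 2 statements merged into one kernel-verified Lean document; each statement's English description precedes it below -/
import Mathlib

section
/- Let R be a commutative unital semiring which is conical (x + y = 0 implies x = 0 and y = 0), nonelementary (there exist nonzero s, t ∈ R with 1 = s + t), simple for its algebraic pre-order (for all x, y ∈ R with y ≠ 0 there exist n ∈ ℕ and c ∈ R with x + c = n·y), and stably finite (a + y = a implies y = 0). Then R is additively cancellative with respect to the algebraic order: for all a, b, x ∈ R, if there exists c with a + x + c = b + x, then there exists d with a + d = b; in particular a + x = b + x implies a = b. -/
/-- The algebraic pre-order of a semiring. -/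
def AlgLE {R : Type*} [CommSemiring R] (x y : R) : Prop := ∃ c, x + c = y

namespace AlgLE

variable {R : Type*} [CommSemiring R] {x y z w : R}

theorem refl (x : R) : AlgLE x x := ⟨0, add_zero x⟩

theorem trans (h : AlgLE x y) (h' : AlgLE y z) : AlgLE x z := by
  obtain ⟨c, rfl⟩ := h
  obtain ⟨d, rfl⟩ := h'
  exact ⟨c + d, by ring⟩

theorem add (h : AlgLE x y) (h' : AlgLE z w) : AlgLE (x + z) (y + w) := by
  obtain ⟨c, rfl⟩ := h
  obtain ⟨d, rfl⟩ := h'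
  exact ⟨c + d, by ring⟩

theorem mul_left (u : R) (h : AlgLE x y) : AlgLE (u * x) (u * y) := by
  obtain ⟨c, rfl⟩ := h
  exact ⟨u * c, by ring⟩

theorem mul_right (u : R) (h : AlgLE x y) : AlgLE (x * u) (y * u) := by
  simpa only [mul_comm _ u] using h.mul_left u

theorem nsmul_left {m n : ℕ} (h : m ≤ n) (x : R) : AlgLE (m • x) (n • x) := by
  obtain ⟨k, rfl⟩ := Nat.exists_eq_add_of_le h
  exact ⟨k • x, (add_nsmul x m k).symm⟩

theorem sum {ι : Type*} (S : Finset ι) {f g : ι → R} (h : ∀ i ∈ S, AlgLE (f i) (g i)) :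
    AlgLE (∑ i ∈ S, f i) (∑ i ∈ S, g i) := by
  classical
  induction S using Finset.induction_on with
  | empty => exact refl _
  | insert i S hi ih =>
    rw [Finset.sum_insert hi, Finset.sum_insert hi]
    exact (h i (Finset.mem_insert_self i S)).add
      (ih fun j hj => h j (Finset.mem_insert_of_mem hj))

theorem single {ι : Type*} {S : Finset ι} {i : ι} (hi : i ∈ S) (f : ι → R) :
    AlgLE (f i) (∑ j ∈ S, f j) := by
  classical
  exact ⟨_, Finset.add_sum_erase S f hi⟩

/-- An equation `a + x = b + x` persists when `x` is replaced by a larger element. -/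
theorem add_eq_add {a b : R} (h : AlgLE x y) (hab : a + x = b + x) : a + y = b + y := by
  obtain ⟨c, rfl⟩ := h
  rw [← add_assoc, hab, add_assoc]

end AlgLE

theorem Nat.le_choose_of_pos_of_lt : ∀ {n i : ℕ}, 0 < i → i < n → n ≤ n.choose i
  | 0, _, _, h => absurd h (Nat.not_lt_zero _)
  | _ + 1, 0, h, _ => absurd h (Nat.lt_irrefl 0)
  | n + 1, i + 1, _, h => by
    rw [Nat.choose_succ_succ']
    have hpos : 0 < n.choose (i + 1) := Nat.choose_pos (by omega)
    rcases Nat.eq_zero_or_pos i with rfl | hi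
    · simp
    · have := Nat.le_choose_of_pos_of_lt hi (show i < n by omega)
      omega

/-- If `1 = s + t` with `s` and `t` comparable up to multiples, then there are arbitrarily small
elements `h` such that multiplication by `h` preserves the equations `a + x = b + x`. -/
theorem exists_small_add_mul_eq {R : Type*} [CommSemiring R] {s t : R} (hst : (1 : R) = s + t)
    {n : ℕ} (hs : AlgLE s (n • t)) (ht : AlgLE t (n • s)) (M : ℕ) :
    ∃ h : R, AlgLE (M • h) 1 ∧ ∀ a b x : R, a + x = b + x → a + h * x = b + h * x := by
  set K := M * (n + 1) with hK
  set f : ℕ → R := fun i => s ^ (i + 1) * t ^ (K + 2 - (i + 1)) with hf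
  set I : R := ∑ i ∈ Finset.range (K + 1), f i with hI
  have hone : (1 : R) = ∑ i ∈ Finset.range (K + 1), (K + 2).choose (i + 1) • f i
      + t ^ (K + 2) + s ^ (K + 2) := by
    rw [← one_pow (K + 2), hst, add_pow, Finset.sum_range_succ, Finset.sum_range_succ']
    simp [hf, mul_comm]
  have hIn : AlgLE (n • I) ((n + 1) • I) := .nsmul_left n.le_succ I
  have hinner : ∀ i ∈ Finset.range (K + 1), AlgLE (f i) ((n + 1) • I) := fun i hi => by
    refine (AlgLE.single hi f).trans ?_
    simpa using AlgLE.nsmul_left (show 1 ≤ n + 1 by omega) I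
  have hnI : ∀ i ∈ Finset.range (K + 1), AlgLE (n • f i) ((n + 1) • I) := fun i hi => by
    refine AlgLE.trans ?_ hIn
    simpa only [nsmul_eq_mul] using (AlgLE.single hi f).mul_left (n : R)
  have hsK : AlgLE (s ^ (K + 2)) ((n + 1) • I) := by
    refine AlgLE.trans ?_ (hnI K (by simp))
    have hfK : f K = s ^ (K + 1) * t := by
      simp [hf]
    rw [hfK, pow_succ s (K + 1), ← mul_smul_comm]
    exact hs.mul_left _
  have htK : AlgLE (t ^ (K + 2)) ((n + 1) • I) := by
    refine AlgLE.trans ?_ (hnI 0 (by simp))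
    have hf0 : f 0 = t ^ (K + 1) * s := by
      simp [hf, mul_comm]
    rw [hf0, pow_succ t (K + 1), ← mul_smul_comm]
    exact ht.mul_left _
  refine ⟨(n + 1) • I, ?_, fun a b x hab => ?_⟩
  · have hle : AlgLE (K • I) (∑ i ∈ Finset.range (K + 1), (K + 2).choose (i + 1) • f i) := by
      rw [hI, Finset.smul_sum]
      refine AlgLE.sum _ fun i hi => AlgLE.nsmul_left ?_ _
      rw [Finset.mem_range] at hi
      have := Nat.le_choose_of_pos_of_lt i.add_one_pos (show i + 1 < K + 2 by omega)
      omega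
    rw [← mul_nsmul', ← hK]
    refine hle.trans ⟨t ^ (K + 2) + s ^ (K + 2), ?_⟩
    rw [← add_assoc, ← hone]
  · set y := ((n + 1) • I) * x
    have hword : ∀ u : R, AlgLE u ((n + 1) • I) → u * a + y = u * b + y := fun u hu =>
      (hu.mul_right x).add_eq_add (by rw [← mul_add, hab, mul_add])
    have hadd : ∀ u v : R, u * a + y = u * b + y → v * a + y = v * b + y →
        (u + v) * a + y = (u + v) * b + y := fun u v hu hv => by
      rw [add_mul, add_assoc, hv, add_left_comm, hu, add_left_comm, ← add_assoc, ← add_mul]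
    have hzero : (0 : R) * a + y = 0 * b + y := by simp
    have hsmul : ∀ (k : ℕ) (u : R), u * a + y = u * b + y →
        (k • u) * a + y = (k • u) * b + y := fun k u hu => by
      induction k with
      | zero => simp
      | succ k ih => rw [succ_nsmul]; exact hadd _ _ ih hu
    have key : (1 : R) * a + y = 1 * b + y := by
      rw [hone]
      refine hadd _ _ (hadd _ _ ?_ (hword _ htK)) (hword _ hsK)
      exact Finset.sum_induction _ (fun u => u * a + y = u * b + y) hadd hzero
        fun i hi => hsmul _ _ (hword _ (hinner i hi))
    simpa only [one_mul] using key

/-- Let `R` be a commutative unital semiring that is conical,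
nonelementary, simple for its algebraic pre-order, and stably finite.  Then
`R` is additively cancellative with respect to the algebraic order: if
`a + x ≤ b + x` (algebraically) then `a ≤ b` (algebraically); in particular
`a + x = b + x` implies `a = b`. -/
theorem stmt8 {R : Type*} [CommSemiring R]
    (hconical : ∀ x y : R, x + y = 0 → x = 0 ∧ y = 0)
    (hnonelem : ∃ s t : R, s ≠ 0 ∧ t ≠ 0 ∧ (1 : R) = s + t)
    (hsimple : ∀ x y : R, y ≠ 0 → ∃ (n : ℕ) (c : R), x + c = n • y)
    (hsf : ∀ a y : R, a + y = a → y = 0) :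
    (∀ a b x : R, (∃ c, a + x + c = b + x) → ∃ d, a + d = b) ∧
    (∀ a b x : R, a + x = b + x → a = b) := by
  obtain ⟨s, t, hs0, ht0, hst⟩ := hnonelem
  have hmul : ∀ u v : R, u ≠ 0 → v ≠ 0 → u * v ≠ 0 := fun u v hu hv huv => by
    obtain ⟨n, c, hc⟩ := hsimple 1 v hv
    have h : u + u * c = 0 := by
      calc u + u * c = u * (1 + c) := by ring
        _ = n • (u * v) := by rw [hc, mul_smul_comm]
        _ = 0 := by rw [huv, nsmul_zero]
    exact hu (hconical _ _ h).1
  have hcancel : ∀ a b x : R, a + x = b + x → a = b := fun a b x hab => by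
    rcases eq_or_ne a 0 with rfl | ha
    · exact (hsf x b (by rw [add_comm, ← hab, zero_add])).symm
    rcases eq_or_ne b 0 with rfl | hb
    · exact hsf x a (by rw [add_comm, hab, zero_add])
    obtain ⟨n₁, hn₁⟩ := hsimple s t ht0
    obtain ⟨n₂, hn₂⟩ := hsimple t s hs0
    obtain ⟨m₁, hm₁⟩ := hsimple x (s * a) (hmul s a hs0 ha)
    obtain ⟨m₂, hm₂⟩ := hsimple x (t * b) (hmul t b ht0 hb)
    obtain ⟨h, hsmall, hdom⟩ := exists_small_add_mul_eq hst
      (AlgLE.trans hn₁ (.nsmul_left (Nat.le_add_right n₁ n₂) t))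
      (AlgLE.trans hn₂ (.nsmul_left (Nat.le_add_left n₂ n₁) s)) (m₁ + m₂)
    have hbound : ∀ (m : ℕ) (z : R), m ≤ m₁ + m₂ → AlgLE x (m • z) → AlgLE (h * x) z :=
      fun m z hm hx => by
        have h₁ := ((AlgLE.nsmul_left hm h).trans hsmall).mul_right z
        rw [one_mul] at h₁
        refine (hx.mul_left h).trans ?_
        rwa [mul_smul_comm, ← smul_mul_assoc]
    have hy₁ : AlgLE (h * x) (s * a) := hbound m₁ _ (Nat.le_add_right _ _) hm₁
    have hy₂ : AlgLE (h * x) (t * b) := hbound m₂ _ (Nat.le_add_left _ _) hm₂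
    have hy := hdom a b x hab
    have hu : ∀ u : R, AlgLE u 1 → u * a + h * x = u * b + h * x := fun u hu => by
      have h₁ := hu.mul_right (h * x)
      rw [one_mul] at h₁
      exact h₁.add_eq_add (by rw [← mul_add, hy, mul_add])
    calc a = t * a + s * a := by rw [← add_mul, add_comm t, ← hst, one_mul]
      _ = t * b + s * a := hy₁.add_eq_add (hu t ⟨s, by rw [hst, add_comm]⟩)
      _ = s * a + t * b := add_comm _ _
      _ = s * b + t * b := hy₂.add_eq_add (hu s ⟨t, hst.symm⟩)
      _ = b := by rw [← add_mul, ← hst, one_mul]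
  refine ⟨fun a b x ⟨c, hc⟩ => ⟨c, hcancel _ _ x ?_⟩, hcancel⟩
  rw [← hc, add_right_comm]
end

section
/- Let S be a Cu-semigroup. Then: (1) if a, b ∈ S are soft, then a + b is soft, and the supremum of any increasing sequence of soft elements of S is soft; (2) if a ∈ S is soft and b ∈ S satisfies that for every b' ∈ S with b' ≪ b there exists n ∈ ℕ with b' ≤ n·a, then a + b is soft. -/
open scoped ENNReal

/-- The (sequential) way-below relation: `a ≪ b` if for every increasing
sequence `f` with a supremum `s` such that `b ≤ s`, some `f n` dominates `a`. -/
def CuWayBelow {S : Type*} [Preorder S] (a b : S) : Prop :=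
  ∀ f : ℕ → S, Monotone f → ∀ s : S, IsLUB (Set.range f) s → b ≤ s → ∃ n : ℕ, a ≤ f n

/-- An abstract Cu-semigroup: a positively ordered monoid satisfying the
axioms (O1)-(O4). -/
structure IsCuSemigroup (S : Type*) [AddCommMonoid S] [PartialOrder S] : Prop where
  /-- addition is order-preserving -/
  add_le_add : ∀ a b c : S, a ≤ b → a + c ≤ b + c
  /-- `0` is the least element -/
  zero_le : ∀ a : S, 0 ≤ a
  /-- (O1) every increasing sequence has a supremum -/
  O1 : ∀ f : ℕ → S, Monotone f → ∃ s : S, IsLUB (Set.range f) s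
  /-- (O2) every element is the supremum of a rapidly increasing sequence -/
  O2 : ∀ a : S, ∃ f : ℕ → S, (∀ n : ℕ, CuWayBelow (f n) (f (n + 1))) ∧ IsLUB (Set.range f) a
  /-- (O3) way-below is additive -/
  O3 : ∀ a' a b' b : S, CuWayBelow a' a → CuWayBelow b' b → CuWayBelow (a' + b') (a + b)
  /-- (O4) suprema of increasing sequences are additive -/
  O4 : ∀ f g : ℕ → S, Monotone f → Monotone g → ∀ s t : S, IsLUB (Set.range f) s →
    IsLUB (Set.range g) t → IsLUB (Set.range (fun n => f n + g n)) (s + t)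

/-- An element `a` of a Cu-semigroup is soft if every `a' ≪ a` satisfies
`(n+1)•a' ≤ n•a` for some `n`. -/
def CuSoft {S : Type*} [AddCommMonoid S] [PartialOrder S] (a : S) : Prop :=
  ∀ a' : S, CuWayBelow a' a → ∃ n : ℕ, (n + 1) • a' ≤ n • a

section CuSemigroup

variable {S : Type*}

theorem CuWayBelow.le [Preorder S] {a b : S} (h : CuWayBelow a b) : a ≤ b := by
  obtain ⟨_, hn⟩ := h (fun _ => b) monotone_const b (by simp) le_rfl
  exact hn

theorem CuWayBelow.trans_le [Preorder S] {a b c : S} (h : CuWayBelow a b) (hbc : b ≤ c) :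
    CuWayBelow a c :=
  fun f hf s hs hcs => h f hf s hs (hbc.trans hcs)

theorem LE.le.trans_cuWayBelow [Preorder S] {a b c : S} (hab : a ≤ b) (h : CuWayBelow b c) :
    CuWayBelow a c := fun f hf s hs hcs =>
  let ⟨n, hn⟩ := h f hf s hs hcs
  ⟨n, hab.trans hn⟩

variable [AddCommMonoid S] [PartialOrder S]

theorem IsCuSemigroup.isOrderedAddMonoid (hS : IsCuSemigroup S) : IsOrderedAddMonoid S where
  add_le_add_left a b h c := hS.add_le_add a b c h

/-- Every element is the supremum of an increasing sequence, each term of which is way below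
both its successor and the element itself. -/
theorem IsCuSemigroup.exists_rapidly_increasing (hS : IsCuSemigroup S) (a : S) :
    ∃ f : ℕ → S, Monotone f ∧ (∀ n, CuWayBelow (f n) (f (n + 1))) ∧
      (∀ n, CuWayBelow (f n) a) ∧ IsLUB (Set.range f) a := by
  obtain ⟨f, hf, ha⟩ := hS.O2 a
  exact ⟨f, monotone_nat_of_le_succ fun n => (hf n).le, hf,
    fun n => (hf n).trans_le (ha.1 ⟨n + 1, rfl⟩), ha⟩

theorem IsCuSemigroup.isLUB_nsmul (hS : IsCuSemigroup S) {f : ℕ → S} (hf : Monotone f) {a : S}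
    (ha : IsLUB (Set.range f) a) (k : ℕ) : IsLUB (Set.range fun n => k • f n) (k • a) := by
  have := hS.isOrderedAddMonoid
  induction k with
  | zero => simp
  | succ k ih =>
    simp only [succ_nsmul]
    exact hS.O4 _ f (fun _ _ h => nsmul_le_nsmul_right (hf h) k) hf _ a ih ha

theorem CuSoft.exists_forall_ge [IsOrderedAddMonoid S] {a a' : S} (ha : CuSoft a)
    (h : CuWayBelow a' a) : ∃ n : ℕ, ∀ N ≥ n, (N + 1) • a' ≤ N • a := by
  obtain ⟨n, hn⟩ := ha a' h
  refine ⟨n, fun N hN => ?_⟩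
  obtain ⟨r, rfl⟩ := Nat.exists_eq_add_of_le hN
  rw [add_right_comm, add_nsmul a' (n + 1), add_nsmul a n]
  exact add_le_add hn (nsmul_le_nsmul_right h.le r)

theorem CuSoft.exists_add_nsmul_le [IsOrderedAddMonoid S] {a a' : S} (ha : CuSoft a)
    (h : CuWayBelow a' a) (k : ℕ) : ∃ n : ℕ, (n + k) • a' ≤ n • a := by
  obtain ⟨n, hn⟩ := ha a' h
  refine ⟨k * n, ?_⟩
  rw [← Nat.mul_succ, mul_nsmul', mul_nsmul']
  exact nsmul_le_nsmul_right hn k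

theorem CuSoft.add (hS : IsCuSemigroup S) {a b : S} (ha : CuSoft a) (hb : CuSoft b) :
    CuSoft (a + b) := by
  have := hS.isOrderedAddMonoid
  intro x hx
  obtain ⟨f, hf, -, hfa, hfl⟩ := hS.exists_rapidly_increasing a
  obtain ⟨g, hg, -, hgb, hgl⟩ := hS.exists_rapidly_increasing b
  obtain ⟨i, hi⟩ := hx _ (hf.add hg) _ (hS.O4 f g hf hg a b hfl hgl) le_rfl
  obtain ⟨n, hn⟩ := ha.exists_forall_ge (hfa i)
  obtain ⟨m, hm⟩ := hb.exists_forall_ge (hgb i)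
  refine ⟨max n m, (nsmul_le_nsmul_right hi _).trans ?_⟩
  rw [nsmul_add, nsmul_add]
  exact add_le_add (hn _ (le_max_left n m)) (hm _ (le_max_right n m))

theorem CuSoft.of_isLUB (hS : IsCuSemigroup S) {f : ℕ → S} (hf : Monotone f)
    (hsoft : ∀ n, CuSoft (f n)) {s : S} (hs : IsLUB (Set.range f) s) : CuSoft s := by
  have := hS.isOrderedAddMonoid
  intro x hx
  obtain ⟨g, hg, hgs, hgb, hgl⟩ := hS.exists_rapidly_increasing s
  obtain ⟨i, hi⟩ := hx g hg s hgl le_rfl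
  obtain ⟨m, hm⟩ := hgb (i + 1) f hf s hs le_rfl
  obtain ⟨n, hn⟩ := hsoft m x ((hi.trans_cuWayBelow (hgs i)).trans_le hm)
  exact ⟨n, hn.trans (nsmul_le_nsmul_right (hs.1 ⟨m, rfl⟩) n)⟩

theorem CuSoft.add_of_forall_le_nsmul (hS : IsCuSemigroup S) {a b : S} (ha : CuSoft a)
    (hb : ∀ b', CuWayBelow b' b → ∃ n : ℕ, b' ≤ n • a) : CuSoft (a + b) := by
  have := hS.isOrderedAddMonoid
  intro x hx
  obtain ⟨f, hf, -, hfa, hfl⟩ := hS.exists_rapidly_increasing a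
  obtain ⟨g, hg, hgs, hgb, hgl⟩ := hS.exists_rapidly_increasing b
  obtain ⟨i, hi⟩ := hx _ (hf.add hg) _ (hS.O4 f g hf hg a b hfl hgl) le_rfl
  obtain ⟨k, hk⟩ := hb _ (hgb (i + 1))
  obtain ⟨j, hj⟩ := hgs i _ (fun _ _ h => nsmul_le_nsmul_right (hf h) k) _
    (hS.isLUB_nsmul hf hfl k) hk
  have hfi : f i ≤ f (max i j) := hf (le_max_left i j)
  have hgi : g i ≤ k • f (max i j) := hj.trans (nsmul_le_nsmul_right (hf (le_max_right i j)) k)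
  obtain ⟨n, hn⟩ := ha.exists_add_nsmul_le (hfa (max i j)) (k + 1)
  refine ⟨n, ?_⟩
  calc (n + 1) • x ≤ (n + 1) • (f i + g i) := nsmul_le_nsmul_right hi _
    _ = (n + 1) • f i + (g i + n • g i) := by rw [nsmul_add, succ_nsmul' (g i)]
    _ ≤ (n + 1) • f (max i j) + (k • f (max i j) + n • b) :=
      add_le_add (nsmul_le_nsmul_right hfi _)
        (add_le_add hgi (nsmul_le_nsmul_right (hgb i).le n))
    _ = (n + (k + 1)) • f (max i j) + n • b := by
      rw [← add_assoc, ← add_nsmul, add_assoc, add_comm 1 k]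
    _ ≤ n • a + n • b := add_le_add_left hn _
    _ = n • (a + b) := (nsmul_add a b n).symm

end CuSemigroup

/-- Let `S` be a Cu-semigroup.  Then:
(1) sums of soft elements are soft, and suprema of increasing sequences of
soft elements are soft;
(2) if `a` is soft and every `b' ≪ b` satisfies `b' ≤ n•a` for some `n`, then
`a + b` is soft. -/
theorem stmt13 {S : Type*} [AddCommMonoid S] [PartialOrder S]
    (hS : IsCuSemigroup S) :
    ((∀ a b : S, CuSoft a → CuSoft b → CuSoft (a + b)) ∧
      (∀ f : ℕ → S, Monotone f → (∀ n : ℕ, CuSoft (f n)) →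
        ∀ s : S, IsLUB (Set.range f) s → CuSoft s)) ∧
    (∀ a b : S, CuSoft a →
      (∀ b' : S, CuWayBelow b' b → ∃ n : ℕ, b' ≤ n • a) → CuSoft (a + b)) := by
  exact ⟨⟨fun _ _ ha hb => ha.add hS hb, fun _ hf hsoft _ hs => CuSoft.of_isLUB hS hf hsoft hs⟩,
    fun _ _ ha hb => ha.add_of_forall_le_nsmul hS hb⟩
end
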